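/- Consider θ_{n+1} = θ_n + α_n F_n on Θ = R^D with deterministic time-dependent step sizes α_n > 0. Assume E[‖F_n‖² | 𝔉_n] ≤ K² for a finite constant K > 0, and that F is Lipschitz with constant L: ‖F(θ_a) − F(θ_b)‖ ≤ L ‖θ_a − θ_b‖ for all θ_a, θ_b. Set t_{n,k} = Σ_{i=n}^{n+k−1} α_i and ε_{n,k} = Σ_{i=n}^{n+k−1} α_i². Then for any θ a unique flow φ satisfying φ(t;θ) = θ + ∫₀ᵗ F(φ(τ;θ)) dτ exists, and for all n ≥ 0 and N ≥ 1: sup_{0 ≤ k ≤ N} E[‖θ_{n+k} − φ(t_{n,k}; θ_n)‖² | 𝔉_n]^{1/2} ≤ ((L K / 2) ε_{n,N} + K ε_{n,N}^{1/2}) exp(L t_{n,N}) almost surely. -/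

import Mathlib

open MeasureTheory Filter

section ODE
variable {E : Type*} [NormedAddCommGroup E] [NormedSpace ℝ E] [CompleteSpace E]

lemma aux_weight {L C : ℝ} (hL : 0 < L) (hC : 0 ≤ C) {h : ℝ → E}
    (hb : ∀ τ, 0 ≤ τ → ‖h τ‖ ≤ C * Real.exp (2 * L * τ)) {t : ℝ} (ht : 0 ≤ t) :
    ‖∫ τ in (0:ℝ)..t, h τ‖ ≤ C / (2 * L) * Real.exp (2 * L * t) := by
  have hcont : Continuous (fun τ : ℝ => C * Real.exp (2 * L * τ)) := by fun_prop
  have h1 : ‖∫ τ in (0:ℝ)..t, h τ‖ ≤ ∫ τ in (0:ℝ)..t, C * Real.exp (2 * L * τ) := by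
    apply intervalIntegral.norm_integral_le_of_norm_le ht
    · exact ae_of_all _ fun τ hτ => hb τ hτ.1.le
    · exact hcont.intervalIntegrable _ _
  have h2 : ∫ τ in (0:ℝ)..t, C * Real.exp (2 * L * τ)
      = C / (2 * L) * Real.exp (2 * L * t) - C / (2 * L) * Real.exp (2 * L * 0) := by
    apply intervalIntegral.integral_eq_sub_of_hasDerivAt
      (f := fun τ => C / (2 * L) * Real.exp (2 * L * τ))
    · intro x _
      have := (((hasDerivAt_id x).const_mul (2 * L)).exp).const_mul (C / (2 * L))
      refine this.congr_deriv ?_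
      simp only [id]
      field_simp
    · exact hcont.intervalIntegrable _ _
  have h3 : 0 ≤ C / (2 * L) * Real.exp (2 * L * 0) := by positivity
  linarith

lemma aux_continuous {F : E → E} {L : ℝ} (hL : 0 < L)
    (hLip : ∀ a b : E, ‖F a - F b‖ ≤ L * ‖a - b‖) : LipschitzWith L.toNNReal F := by
  apply LipschitzWith.of_dist_le_mul
  intro a b
  rw [dist_eq_norm, dist_eq_norm, Real.coe_toNNReal _ hL.le]
  exact hLip a b

lemma aux_exists {F : E → E} {L : ℝ} (hL : 0 < L)
    (hLip : ∀ a b : E, ‖F a - F b‖ ≤ L * ‖a - b‖) (ϑ : E) :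
    ∃ x : ℝ → E, Continuous x ∧ ∀ t, 0 ≤ t → x t = ϑ + ∫ τ in (0:ℝ)..t, F (x τ) := by
  have hF : Continuous F := (aux_continuous hL hLip).continuous
  let Q : (BoundedContinuousFunction ℝ E) → ℝ → E := fun y t =>
    Real.exp (-(2 * L * max t 0)) • ∫ τ in (0:ℝ)..(max t 0), F (ϑ + Real.exp (2 * L * τ) • y τ)
  have hint : ∀ y : BoundedContinuousFunction ℝ E,
      Continuous fun τ : ℝ => F (ϑ + Real.exp (2 * L * τ) • y τ) := by
    intro y; have := y.continuous; fun_prop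
  have hw : ∀ (h : ℝ → E) (C : ℝ), 0 ≤ C → (∀ τ, 0 ≤ τ → ‖h τ‖ ≤ C * Real.exp (2 * L * τ)) →
      ∀ t : ℝ, ‖Real.exp (-(2 * L * max t 0)) • ∫ τ in (0:ℝ)..(max t 0), h τ‖ ≤ C / (2 * L) := by
    intro h C hC hb t
    have := aux_weight hL hC hb (le_max_right t 0)
    rw [norm_smul, Real.norm_of_nonneg (Real.exp_pos _).le, Real.exp_neg,
      inv_mul_le_iff₀ (Real.exp_pos _)]
    linarith
  have hQc : ∀ y, Continuous (Q y) := by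
    intro y
    have h1 : Continuous fun t : ℝ => ∫ τ in (0:ℝ)..t, F (ϑ + Real.exp (2 * L * τ) • y τ) :=
      intervalIntegral.continuous_primitive (fun a b => (hint y).intervalIntegrable a b) 0
    have h2 : Continuous fun t : ℝ => max t 0 := by fun_prop
    exact (by fun_prop : Continuous fun t : ℝ => Real.exp (-(2 * L * max t 0))).smul (h1.comp h2)
  have hQb : ∀ y, ∀ t, ‖Q y t‖ ≤ (‖F ϑ‖ + L * ‖y‖) / (2 * L) := by
    intro y t
    apply hw _ _ (by positivity)
    intro τ hτ
    have h1 := hLip (ϑ + Real.exp (2 * L * τ) • y τ) ϑ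
    rw [add_sub_cancel_left, norm_smul, Real.norm_of_nonneg (Real.exp_pos _).le] at h1
    have h2 := norm_sub_norm_le (F (ϑ + Real.exp (2 * L * τ) • y τ)) (F ϑ)
    have h3 := y.norm_coe_le_norm τ
    have h4 : 1 ≤ Real.exp (2 * L * τ) := Real.one_le_exp (by positivity)
    have h5 : L * (Real.exp (2 * L * τ) * ‖y τ‖) ≤ L * (Real.exp (2 * L * τ) * ‖y‖) := by gcongr
    nlinarith [norm_nonneg (F ϑ)]
  let P : BoundedContinuousFunction ℝ E → BoundedContinuousFunction ℝ E := fun y =>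
    BoundedContinuousFunction.ofNormedAddCommGroup (Q y) (hQc y) _ (hQb y)
  have hP : ContractingWith (1 / 2) P := by
    refine ⟨by rw [← NNReal.coe_lt_coe]; norm_num, LipschitzWith.of_dist_le_mul fun y z => ?_⟩
    rw [BoundedContinuousFunction.dist_le (by positivity)]
    intro t
    have h0 : P y t - P z t = Real.exp (-(2 * L * max t 0)) • ∫ τ in (0:ℝ)..(max t 0),
        (F (ϑ + Real.exp (2 * L * τ) • y τ) - F (ϑ + Real.exp (2 * L * τ) • z τ)) := by
      rw [intervalIntegral.integral_sub ((hint y).intervalIntegrable _ _)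
        ((hint z).intervalIntegrable _ _), smul_sub]
      rfl
    rw [dist_eq_norm, h0]
    refine (hw _ (L * dist y z) (by positivity) ?_ t).trans (le_of_eq ?_)
    · intro τ _
      refine (hLip _ _).trans ?_
      rw [add_sub_add_left_eq_sub, ← smul_sub, norm_smul,
        Real.norm_of_nonneg (Real.exp_pos _).le, ← dist_eq_norm]
      have := BoundedContinuousFunction.dist_coe_le_dist (f := y) (g := z) τ
      have h5 : L * (Real.exp (2 * L * τ) * dist (y τ) (z τ))
        ≤ L * (Real.exp (2 * L * τ) * dist y z) := by gcongr
      linarith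
    · simp; field_simp
  have hfix : P (hP.fixedPoint) = hP.fixedPoint := hP.fixedPoint_isFixedPt
  set y := hP.fixedPoint with hy
  refine ⟨fun τ => ϑ + Real.exp (2 * L * τ) • y τ, ?_, ?_⟩
  · have := y.continuous; fun_prop
  · intro t ht
    have h1 : y t = Q y t := by
      conv_lhs => rw [← hfix]
      rfl
    simp only [h1, Q, max_eq_left ht, smul_smul, ← Real.exp_add]
    simp

/-- right derivative of a solution of the integral equation -/
lemma aux_deriv {F : E → E} (hF : Continuous F) {ϑ : E} {x : ℝ → E} {T : ℝ}
    (hx : ContinuousOn x (Set.Icc 0 T))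
    (hi : ∀ t ∈ Set.Icc 0 T, x t = ϑ + ∫ τ in (0:ℝ)..t, F (x τ)) :
    ∀ t ∈ Set.Ico 0 T, HasDerivWithinAt x (F (x t)) (Set.Ici t) t := by
  intro t ht
  have hFx : ContinuousOn (fun τ => F (x τ)) (Set.Icc 0 T) := hF.comp_continuousOn hx
  have hmem : Set.Icc 0 T ∈ nhdsWithin t (Set.Ioi t) :=
    mem_of_superset (Ioo_mem_nhdsGT ht.2) fun s hs => ⟨ht.1.trans hs.1.le, hs.2.le⟩
  have hmem' : Set.Icc 0 T ∈ nhdsWithin t (Set.Ici t) :=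
    mem_of_superset (Ico_mem_nhdsGE ht.2) fun s hs => ⟨ht.1.trans hs.1, hs.2.le⟩
  have hII : IntervalIntegrable (fun τ => F (x τ)) volume 0 t := by
    apply ContinuousOn.intervalIntegrable
    rw [Set.uIcc_of_le ht.1]
    exact hFx.mono (Set.Icc_subset_Icc_right ht.2.le)
  have h1 : HasDerivWithinAt (fun u => ∫ τ in (0:ℝ)..u, F (x τ)) (F (x t)) (Set.Ici t) t := by
    apply intervalIntegral.integral_hasDerivWithinAt_right hII (t := Set.Ioi t)
    · exact ⟨Set.Icc 0 T, hmem, hFx.aestronglyMeasurable measurableSet_Icc⟩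
    · exact ((hFx t ⟨ht.1, ht.2.le⟩).mono_of_mem_nhdsWithin hmem)
  have h2 := h1.const_add ϑ
  refine h2.congr_of_eventuallyEq ?_ (hi t ⟨ht.1, ht.2.le⟩)
  filter_upwards [hmem'] with s hs using hi s hs

/-- Lipschitz dependence on initial conditions. -/
lemma aux_gron {F : E → E} {L : ℝ} (hL : 0 < L)
    (hLip : ∀ a b : E, ‖F a - F b‖ ≤ L * ‖a - b‖) {a b : E} {x y : ℝ → E} {T : ℝ} (hT : 0 ≤ T)
    (hx : ContinuousOn x (Set.Icc 0 T)) (hy : ContinuousOn y (Set.Icc 0 T))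
    (hxi : ∀ t ∈ Set.Icc 0 T, x t = a + ∫ τ in (0:ℝ)..t, F (x τ))
    (hyi : ∀ t ∈ Set.Icc 0 T, y t = b + ∫ τ in (0:ℝ)..t, F (y τ)) :
    ‖x T - y T‖ ≤ Real.exp (L * T) * ‖a - b‖ := by
  have hl := aux_continuous hL hLip
  have h0 : dist (x 0) (y 0) ≤ ‖a - b‖ := by
    rw [hxi 0 ⟨le_rfl, hT⟩, hyi 0 ⟨le_rfl, hT⟩]; simp [dist_eq_norm]
  have := dist_le_of_trajectories_ODE (v := fun _ => F) (fun _ => hl) hx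
    (aux_deriv hl.continuous hx hxi) hy (aux_deriv hl.continuous hy hyi) h0 T ⟨hT, le_rfl⟩
  rw [Real.coe_toNNReal _ hL.le, dist_eq_norm, sub_zero, mul_comm] at this
  exact this

/-- uniqueness, without any regularity assumption on `y` -/
lemma aux_unique {F : E → E} {L : ℝ} (hL : 0 < L)
    (hLip : ∀ a b : E, ‖F a - F b‖ ≤ L * ‖a - b‖) {ϑ : E} {x y : ℝ → E} (hx : Continuous x)
    (hxi : ∀ t, 0 ≤ t → x t = ϑ + ∫ τ in (0:ℝ)..t, F (x τ))
    (hyi : ∀ t, 0 ≤ t → y t = ϑ + ∫ τ in (0:ℝ)..t, F (y τ)) :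
    ∀ t, 0 ≤ t → y t = x t := by
  have hF := (aux_continuous hL hLip).continuous
  have key : ∀ t, 0 ≤ t → IntervalIntegrable (fun τ => F (y τ)) volume 0 t → y t = x t := by
    intro t ht hI
    have hc : ContinuousOn y (Set.Icc 0 t) := by
      have h1 : ContinuousOn (fun s => ϑ + ∫ τ in (0:ℝ)..s, F (y τ)) (Set.Icc 0 t) := by
        apply ContinuousOn.add continuousOn_const
        have := intervalIntegral.continuousOn_primitive_interval (μ := volume)
          (f := fun τ => F (y τ)) (a := 0) (b := t) ?_
        · rwa [Set.uIcc_of_le ht] at this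
        · rwa [Set.uIcc_of_le ht, integrableOn_Icc_iff_integrableOn_Ioc,
            ← intervalIntegrable_iff_integrableOn_Ioc_of_le ht]
      exact h1.congr fun s hs => hyi s hs.1
    have := aux_gron hL hLip ht hc hx.continuousOn (fun s hs => hyi s hs.1)
      (fun s hs => hxi s hs.1)
    simp only [sub_self, norm_zero, mul_zero] at this
    exact sub_eq_zero.1 (norm_le_zero_iff.1 this)
  intro t0 ht0
  apply key t0 ht0
  by_contra hn
  set S := {t : ℝ | 0 ≤ t ∧ IntervalIntegrable (fun τ => F (y τ)) volume 0 t} with hS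
  have hdown : ∀ s ∈ S, ∀ r, 0 ≤ r → r ≤ s → r ∈ S := by
    intro s hs r hr hrs
    refine ⟨hr, hs.2.mono_set ?_⟩
    rw [Set.uIcc_of_le hr, Set.uIcc_of_le hs.1]
    exact Set.Icc_subset_Icc_right hrs
  have hub : ∀ s ∈ S, s ≤ t0 := by
    intro s hs
    by_contra h
    exact hn (hdown s hs t0 ht0 (not_le.1 h).le).2
  have hbdd : BddAbove S := ⟨t0, hub⟩
  have h0S : (0:ℝ) ∈ S := ⟨le_rfl, by simp⟩
  have hT0 : 0 ≤ sSup S := le_csSup hbdd h0S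
  have hTt : sSup S ≤ t0 := csSup_le ⟨0, h0S⟩ hub
  have hlt : ∀ s, 0 ≤ s → s < sSup S → y s = x s := by
    intro s hs hsT
    obtain ⟨r, hr, hsr⟩ := exists_lt_of_lt_csSup ⟨0, h0S⟩ hsT
    exact key s hs (hdown r hr s hs hsr.le).2
  have hgt : ∀ s, sSup S < s → y s = ϑ := by
    intro s hs
    have hs0 := hT0.trans hs.le
    have : ¬ IntervalIntegrable (fun τ => F (y τ)) volume 0 s := fun h =>
      absurd (le_csSup hbdd (show s ∈ S from ⟨hs0, h⟩)) (not_le.2 hs)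
    rw [hyi s hs0, intervalIntegral.integral_undef this, add_zero]
  apply hn
  refine IntervalIntegrable.trans (b := sSup S) ?_ ?_
  · have h1 : IntervalIntegrable (fun τ => F (x τ)) volume 0 (sSup S) :=
      (hF.comp hx).intervalIntegrable _ _
    refine h1.congr_ae ?_
    rw [Set.uIoc_of_le hT0, EventuallyEq, ae_restrict_iff' measurableSet_Ioc]
    have : ∀ᵐ s : ℝ, s ≠ sSup S := by simp [ae_iff]
    filter_upwards [this] with s hs hs'
    rw [hlt s hs'.1.le (lt_of_le_of_ne hs'.2 hs)]
  · have h1 : IntervalIntegrable (fun _ => F ϑ) volume (sSup S) t0 := intervalIntegrable_const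
    refine h1.congr_ae ?_
    rw [Set.uIoc_of_le hTt, EventuallyEq, ae_restrict_iff' measurableSet_Ioc]
    exact ae_of_all _ fun s hs => by rw [hgt s hs.1]

/-- one Euler step -/
lemma aux_euler {F : E → E} {L : ℝ} (hL : 0 < L)
    (hLip : ∀ a b : E, ‖F a - F b‖ ≤ L * ‖a - b‖) {ϑ : E} {x : ℝ → E} (hx : Continuous x)
    (hxi : ∀ t, 0 ≤ t → x t = ϑ + ∫ τ in (0:ℝ)..t, F (x τ)) {α : ℝ} (hα : 0 ≤ α) :
    ‖ϑ + α • F ϑ - x α‖ ≤ ‖F ϑ‖ * (L * α ^ 2 / 2) * Real.exp (L * α) := by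
  have hF := (aux_continuous hL hLip).continuous
  have h1 : ∀ τ ∈ Set.Icc 0 α, ‖x τ - ϑ‖ ≤ gronwallBound 0 L ‖F ϑ‖ (τ - 0) := by
    apply norm_le_gronwallBound_of_norm_deriv_right_le (f := fun τ => x τ - ϑ)
      (f' := fun τ => F (x τ))
    · exact (by fun_prop : Continuous fun τ => x τ - ϑ).continuousOn
    · intro t ht
      exact (aux_deriv hF hx.continuousOn (fun s hs => hxi s hs.1) t ht).sub_const ϑ
    · rw [hxi 0 le_rfl]; simp
    · intro t _
      have := hLip (x t) ϑ
      have := norm_sub_norm_le (F (x t)) (F ϑ)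
      linarith
  have h2 : ∀ τ ∈ Set.Icc 0 α, ‖x τ - ϑ‖ ≤ ‖F ϑ‖ * τ * Real.exp (L * α) := by
    intro τ hτ
    refine (h1 τ hτ).trans ?_
    rw [gronwallBound_of_K_ne_0 hL.ne', sub_zero]
    simp only [zero_mul, zero_add]
    have e1 : Real.exp (L * τ) - 1 ≤ L * τ * Real.exp (L * τ) := by
      have h := Real.add_one_le_exp (-(L * τ))
      have h' : Real.exp (L * τ) * Real.exp (-(L * τ)) = 1 := by rw [← Real.exp_add]; simp
      nlinarith [Real.exp_pos (L * τ)]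
    have e2 : Real.exp (L * τ) ≤ Real.exp (L * α) := by
      have := hτ.2
      gcongr
    have hτ0 := hτ.1
    calc ‖F ϑ‖ / L * (Real.exp (L * τ) - 1) ≤ ‖F ϑ‖ / L * (L * τ * Real.exp (L * α)) := by
          gcongr
          exact e1.trans (by gcongr)
      _ = _ := by field_simp
  have h3 : ϑ + α • F ϑ - x α = ∫ τ in (0:ℝ)..α, (F ϑ - F (x τ)) := by
    have hI : IntervalIntegrable (fun τ => F (x τ)) volume 0 α :=
      (hF.comp hx).intervalIntegrable _ _
    rw [intervalIntegral.integral_sub intervalIntegrable_const hI, hxi α hα]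
    simp
  rw [h3]
  have h4 : ‖∫ τ in (0:ℝ)..α, (F ϑ - F (x τ))‖
      ≤ ∫ τ in (0:ℝ)..α, (L * ‖F ϑ‖ * Real.exp (L * α)) * τ := by
    apply intervalIntegral.norm_integral_le_of_norm_le hα
    · refine ae_of_all _ fun τ hτ => ?_
      have := h2 τ ⟨hτ.1.le, hτ.2⟩
      have h5 := hLip (x τ) ϑ
      rw [norm_sub_rev]
      nlinarith
    · exact (by fun_prop : Continuous fun τ : ℝ =>
        (L * ‖F ϑ‖ * Real.exp (L * α)) * τ).intervalIntegrable _ _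
  refine h4.trans (le_of_eq ?_)
  rw [intervalIntegral.integral_const_mul, integral_id]
  ring

end ODE

section Prob
variable {E : Type*} [NormedAddCommGroup E] [InnerProductSpace ℝ E] [CompleteSpace E]

lemma aux_sq_int {Ω : Type*} {m0 : MeasurableSpace Ω} {μ : Measure Ω} {f : Ω → E}
    (hf : MemLp f 2 μ) : Integrable (fun ω => ‖f ω‖ ^ 2) μ :=
  (memLp_two_iff_integrable_sq_norm hf.1).1 hf

lemma aux_inner_int {Ω : Type*} {m0 : MeasurableSpace Ω} {μ : Measure Ω} {f g : Ω → E}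
    (hf : MemLp f 2 μ) (hg : MemLp g 2 μ) : Integrable (fun ω => inner ℝ (f ω) (g ω)) μ := by
  refine ((aux_sq_int hf).add (aux_sq_int hg)).mono' (hf.1.inner hg.1) (ae_of_all _ fun ω => ?_)
  have := norm_inner_le_norm (𝕜 := ℝ) (f ω) (g ω)
  simp only [Pi.add_apply]
  nlinarith [sq_nonneg (‖f ω‖ - ‖g ω‖), norm_nonneg (f ω), norm_nonneg (g ω)]

lemma aux_step {Ω : Type*} {m m' m0 : MeasurableSpace Ω} (hmm : m ≤ m') (hm0 : m' ≤ m0)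
    {μ : Measure Ω} [IsProbabilityMeasure μ] {δ W G g : Ω → E} {α K r c B : ℝ}
    (hWm : StronglyMeasurable[m'] W) (hW : MemLp W 2 μ) (hG : MemLp G 2 μ) (hδ : MemLp δ 2 μ)
    (hg : μ[G | m'] =ᵐ[μ] g)
    (hK : ∀ᵐ ω ∂μ, (μ[fun ω' => ‖G ω'‖ ^ 2 | m']) ω ≤ K ^ 2)
    (hA : ∀ᵐ ω ∂μ, ‖W ω + α • g ω‖ ≤ r * (‖δ ω‖ + c))
    (hc : 0 ≤ c)
    (hB : 0 < B ∨ (B = 0 ∧ ∀ ω, δ ω = 0))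
    (hδB : ∀ᵐ ω ∂μ, (μ[fun ω' => ‖δ ω'‖ ^ 2 | m]) ω ≤ B ^ 2) :
    ∀ᵐ ω ∂μ, (μ[fun ω' => ‖W ω' + α • G ω'‖ ^ 2 | m]) ω ≤ r ^ 2 * (B + c) ^ 2 + α ^ 2 * K ^ 2 := by
  -- linearization
  obtain ⟨a, ha0, ha⟩ : ∃ a : ℝ, 0 ≤ a ∧
      ∀ ω, (‖δ ω‖ + c) ^ 2 ≤ a * ‖δ ω‖ ^ 2 + ((B + c) ^ 2 - a * B ^ 2) := by
    rcases hB with hB | ⟨hB, h0⟩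
    · refine ⟨1 + c / B, by positivity, fun ω => ?_⟩
      have : (1 + c / B) * ‖δ ω‖ ^ 2 + ((B + c) ^ 2 - (1 + c / B) * B ^ 2) - (‖δ ω‖ + c) ^ 2
          = c / B * (‖δ ω‖ - B) ^ 2 := by field_simp; ring
      have h2 : 0 ≤ c / B * (‖δ ω‖ - B) ^ 2 := by positivity
      linarith
    · exact ⟨0, le_rfl, fun ω => by simp [hB, h0 ω]⟩
  have hiW := aux_sq_int hW
  have hiG := aux_sq_int hG
  have hid := aux_sq_int hδ
  have hiWG := aux_inner_int hW hG
  have hGi : Integrable G μ := hG.integrable (by norm_num)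
  -- inner conditional expectation
  have e0 : (fun ω' => ‖W ω' + α • G ω'‖ ^ 2)
      = (fun ω => ‖W ω‖ ^ 2) + ((2 * α) • (fun ω => inner ℝ (W ω) (G ω))
        + (α ^ 2) • (fun ω => ‖G ω‖ ^ 2)) := by
    ext ω
    simp only [Pi.add_apply, Pi.smul_apply, smul_eq_mul]
    rw [norm_add_sq_real, inner_smul_right, norm_smul, mul_pow, Real.norm_eq_abs, sq_abs]
    ring
  have e1 : μ[fun ω => ‖W ω‖ ^ 2 | m'] = fun ω => ‖W ω‖ ^ 2 :=
    condExp_of_stronglyMeasurable hm0 (hWm.norm.pow 2) hiW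
  have e2 : μ[fun ω => inner ℝ (W ω) (G ω) | m'] =ᵐ[μ] fun ω => inner ℝ (W ω) (μ[G | m'] ω) :=
    condExp_bilin_of_stronglyMeasurable_left (innerSL ℝ) hWm hiWG hGi
  have e3 := condExp_add hiW ((hiWG.smul (2 * α)).add (hiG.smul (α ^ 2))) m'
  have e4 := condExp_add (hiWG.smul (2 * α)) (hiG.smul (α ^ 2)) m'
  have e5 := condExp_smul (μ := μ) (2 * α) (fun ω => inner ℝ (W ω) (G ω)) m'
  have e6 := condExp_smul (μ := μ) (α ^ 2) (fun ω => ‖G ω‖ ^ 2) m'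
  have hin : μ[fun ω' => ‖W ω' + α • G ω'‖ ^ 2 | m'] ≤ᵐ[μ]
      (r ^ 2 * a) • (fun ω => ‖δ ω‖ ^ 2)
        + fun _ => r ^ 2 * ((B + c) ^ 2 - a * B ^ 2) + α ^ 2 * K ^ 2 := by
    rw [e0]
    filter_upwards [e2, e3, e4, e5, e6, hg, hK, hA] with ω e2 e3 e4 e5 e6 hg hK hA
    rw [e3, Pi.add_apply, e4, Pi.add_apply, e5, e6, e1]
    simp only [Pi.smul_apply, Pi.add_apply, smul_eq_mul]
    rw [e2, hg]
    have h1 : ‖W ω + α • g ω‖ ^ 2 = ‖W ω‖ ^ 2 + 2 * α * inner ℝ (W ω) (g ω)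
        + α ^ 2 * ‖g ω‖ ^ 2 := by
      rw [norm_add_sq_real, inner_smul_right, norm_smul, mul_pow, Real.norm_eq_abs, sq_abs]
      ring
    have h2 : ‖W ω + α • g ω‖ ^ 2 ≤ (r * (‖δ ω‖ + c)) ^ 2 := by gcongr
    have h3 := mul_le_mul_of_nonneg_left (ha ω) (sq_nonneg r)
    have h4 := mul_le_mul_of_nonneg_left hK (sq_nonneg α)
    have h5 : 0 ≤ α ^ 2 * ‖g ω‖ ^ 2 := by positivity
    rw [mul_pow] at h2
    nlinarith
  have hri : Integrable ((r ^ 2 * a) • (fun ω => ‖δ ω‖ ^ 2)) μ := hid.smul (r ^ 2 * a)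
  have t1 := condExp_condExp_of_le (μ := μ) (f := fun ω' => ‖W ω' + α • G ω'‖ ^ 2) hmm hm0
  have t2 := condExp_mono (m := m) integrable_condExp (hri.add (integrable_const _)) hin
  have t3 := condExp_add hri
    (integrable_const (μ := μ) (r ^ 2 * ((B + c) ^ 2 - a * B ^ 2) + α ^ 2 * K ^ 2)) m
  have t4 := condExp_smul (μ := μ) (r ^ 2 * a) (fun ω => ‖δ ω‖ ^ 2) m
  have t5 := condExp_const (μ := μ) (hmm.trans hm0)
    (r ^ 2 * ((B + c) ^ 2 - a * B ^ 2) + α ^ 2 * K ^ 2)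
  filter_upwards [t1, t2, t3, t4, hδB] with ω t1 t2 t3 t4 hδB
  rw [← t1]
  refine t2.trans ?_
  rw [t3, Pi.add_apply, t4, t5]
  simp only [Pi.smul_apply, smul_eq_mul]
  have := mul_le_mul_of_nonneg_left hδB (by positivity : 0 ≤ r ^ 2 * a)
  nlinarith

lemma aux_bound {Ω : Type*} {m m0 : MeasurableSpace Ω}
    {μ : Measure Ω} {G g : Ω → E} {K : ℝ} (hK0 : 0 < K)
    (hGi : Integrable (fun ω => ‖G ω‖ ^ 2) μ) (hg : μ[G | m] =ᵐ[μ] g)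
    (hK : ∀ᵐ ω ∂μ, (μ[fun ω' => ‖G ω'‖ ^ 2 | m]) ω ≤ K ^ 2) :
    ∀ᵐ ω ∂μ, ‖g ω‖ ≤ K := by
  have h := Integrable.norm_condExp_rpow_le (m := m) (f := G) (p := 2) (by norm_num)
    (by simpa using hGi)
  simp only [Real.rpow_two] at h
  filter_upwards [h, hg, hK] with ω h hg hK
  rw [hg] at h
  exact le_of_sq_le_sq (h.trans hK) hK0.le

end Prob

lemma aux_arith {B ε a t L K : ℝ} (hL : 0 < L) (hK : 0 < K) (hε : 0 ≤ ε)
    (hB : B = (L * K / 2 * ε + K * Real.sqrt ε) * Real.exp (L * t)) (ht : 0 ≤ t) (ha : 0 < a) :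
    (Real.exp (L * a)) ^ 2 * (B + K * (L * a ^ 2 / 2)) ^ 2 + a ^ 2 * K ^ 2 ≤
      ((L * K / 2 * (ε + a ^ 2) + K * Real.sqrt (ε + a ^ 2)) * Real.exp (L * (t + a))) ^ 2 := by
  have e1 : 1 ≤ Real.exp (L * t) := Real.one_le_exp (by positivity)
  have e2 : 1 ≤ Real.exp (L * (t + a)) := Real.one_le_exp (by positivity)
  have e3 : Real.exp (L * (t + a)) = Real.exp (L * a) * Real.exp (L * t) := by
    rw [← Real.exp_add]; ring_nf
  have s1 := Real.sq_sqrt hε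
  have s2 := Real.sq_sqrt (by positivity : 0 ≤ ε + a ^ 2)
  have s3 : Real.sqrt ε ≤ Real.sqrt (ε + a ^ 2) := Real.sqrt_le_sqrt (by nlinarith)
  set p := Real.sqrt ε
  set q := Real.sqrt (ε + a ^ 2)
  have hp : 0 ≤ p := Real.sqrt_nonneg _
  set u := L * K / 2 * (ε + a ^ 2) with hu
  have hu0 : 0 ≤ u := by positivity
  have h1 : B + K * (L * a ^ 2 / 2) ≤ (u + K * p) * Real.exp (L * t) := by
    rw [hB, hu]
    have : 0 ≤ K * (L * a ^ 2 / 2) := by positivity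
    nlinarith
  have h0 : 0 ≤ B + K * (L * a ^ 2 / 2) := by rw [hB]; positivity
  have h2 : (Real.exp (L * a)) ^ 2 * (B + K * (L * a ^ 2 / 2)) ^ 2 ≤
      (Real.exp (L * a)) ^ 2 * ((u + K * p) * Real.exp (L * t)) ^ 2 := by gcongr
  have h3 : (u + K * p) ^ 2 + a ^ 2 * K ^ 2 ≤ (u + K * q) ^ 2 := by
    have : u * K * p ≤ u * K * q := by gcongr
    nlinarith
  have h4 : a ^ 2 * K ^ 2 ≤ a ^ 2 * K ^ 2 * (Real.exp (L * (t + a))) ^ 2 :=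
    le_mul_of_one_le_right (by positivity) (one_le_pow₀ e2)
  calc _ ≤ ((u + K * p) ^ 2 + a ^ 2 * K ^ 2) * (Real.exp (L * (t + a))) ^ 2 := by
        rw [e3] at h4 ⊢; nlinarith
    _ ≤ (u + K * q) ^ 2 * (Real.exp (L * (t + a))) ^ 2 := by gcongr
    _ = _ := by ring

/-- **The basic ODE-method deviation bound.**  Consider `θ_{n+1} = θ_n + α_n F_n` on
`Θ = ℝ^D` with deterministic step sizes `α_n > 0`, with `E[‖F_n‖² | 𝔉_n] ≤ K²` and `F`
Lipschitz with constant `L`.  With `t_{n,k} = Σ_{i=n}^{n+k−1} α_i` and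
`ε_{n,k} = Σ_{i=n}^{n+k−1} α_i²`, a unique flow `φ` solving
`φ(t;θ) = θ + ∫₀ᵗ F(φ(τ;θ)) dτ` exists, and for all `n ≥ 0`, `N ≥ 1`,
`sup_{0≤k≤N} E[‖θ_{n+k} − φ(t_{n,k};θ_n)‖² | 𝔉_n]^{1/2}
  ≤ ((L K/2) ε_{n,N} + K ε_{n,N}^{1/2}) exp(L t_{n,N})` almost surely. -/
theorem stmt6 {D : ℕ} {Ω : Type} {m0 : MeasurableSpace Ω}
    (μ : Measure Ω) [IsProbabilityMeasure μ]
    (𝔉 : Filtration ℕ m0)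
    (θ : ℕ → Ω → EuclideanSpace ℝ (Fin D))
    (Fn : ℕ → Ω → EuclideanSpace ℝ (Fin D))
    (F : EuclideanSpace ℝ (Fin D) → EuclideanSpace ℝ (Fin D))
    (α : ℕ → ℝ) (hα : ∀ n, 0 < α n)
    (hrec : ∀ n ω, θ (n + 1) ω = θ n ω + α n • Fn n ω)
    (hadapted : Adapted 𝔉 θ)
    (hmean : ∀ n, μ[Fn n | 𝔉 n] =ᵐ[μ] fun ω => F (θ n ω))
    (K : ℝ) (hK : 0 < K)
    (hFnint : ∀ n, Integrable (fun ω => ‖Fn n ω‖ ^ 2) μ)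
    (hsecond : ∀ n, ∀ᵐ ω ∂μ, (μ[fun ω' => ‖Fn n ω'‖ ^ 2 | 𝔉 n]) ω ≤ K ^ 2)
    (L : ℝ) (hL : 0 < L)
    (hLip : ∀ θa θb : EuclideanSpace ℝ (Fin D), ‖F θa - F θb‖ ≤ L * ‖θa - θb‖) :
    ∃ φ : ℝ → EuclideanSpace ℝ (Fin D) → EuclideanSpace ℝ (Fin D),
      (∀ ϑ, φ 0 ϑ = ϑ) ∧
      (∀ ϑ, ∀ t : ℝ, 0 ≤ t → φ t ϑ = ϑ + ∫ τ in (0:ℝ)..t, F (φ τ ϑ)) ∧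
      (∀ (ϑ : EuclideanSpace ℝ (Fin D)) (ψ : ℝ → EuclideanSpace ℝ (Fin D)),
        ψ 0 = ϑ → (∀ t : ℝ, 0 ≤ t → ψ t = ϑ + ∫ τ in (0:ℝ)..t, F (ψ τ)) →
        ∀ t : ℝ, 0 ≤ t → ψ t = φ t ϑ) ∧
      (∀ n N : ℕ, 1 ≤ N → ∀ k ≤ N, ∀ᵐ ω ∂μ,
        Real.sqrt
            ((μ[fun ω' =>
                ‖θ (n + k) ω' - φ (∑ i ∈ Finset.range k, α (n + i)) (θ n ω')‖ ^ 2 | 𝔉 n]) ω)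
          ≤ ((L * K / 2) * (∑ i ∈ Finset.range N, (α (n + i)) ^ 2)
                + K * Real.sqrt (∑ i ∈ Finset.range N, (α (n + i)) ^ 2))
              * Real.exp (L * (∑ i ∈ Finset.range N, α (n + i)))) := by
  
  have hFl := aux_continuous hL hLip
  have hF : Continuous F := hFl.continuous
  choose x hxc hxi using aux_exists hL hLip
  have hlip : ∀ t, 0 ≤ t → ∀ a b, ‖x a t - x b t‖ ≤ Real.exp (L * t) * ‖a - b‖ :=
    fun t ht a b => aux_gron hL hLip ht (hxc a).continuousOn (hxc b).continuousOn
      (fun s hs => hxi a s hs.1) (fun s hs => hxi b s hs.1)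
  have hcont : ∀ t, 0 ≤ t → Continuous fun a => x a t := by
    intro t ht
    apply LipschitzWith.continuous (K := (Real.exp (L * t)).toNNReal)
    apply LipschitzWith.of_dist_le_mul
    intro a b
    rw [dist_eq_norm, dist_eq_norm, Real.coe_toNNReal _ (Real.exp_pos _).le]
    exact hlip t ht a b
  have hsemi : ∀ s, 0 ≤ s → ∀ t, 0 ≤ t → ∀ a, x a (s + t) = x (x a s) t := by
    intro s hs t ht a
    refine aux_unique hL hLip (y := fun t => x a (s + t)) (hxc (x a s)) (hxi (x a s)) ?_ t ht
    intro t ht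
    have hI : ∀ p q : ℝ, IntervalIntegrable (fun τ => F (x a τ)) volume p q := fun p q =>
      (hF.comp (hxc a)).intervalIntegrable _ _
    show x a (s + t) = _
    rw [hxi a (s + t) (by positivity), hxi a s hs,
      intervalIntegral.integral_comp_add_left (fun τ => F (x a τ)) s, add_zero, add_assoc,
      intervalIntegral.integral_add_adjacent_intervals (hI _ _) (hI _ _)]
  refine ⟨fun t ϑ => x ϑ t, ?_, ?_, ?_, ?_⟩
  · intro ϑ
    show x ϑ 0 = ϑ
    rw [hxi ϑ 0 le_rfl]; simp
  · intro ϑ t ht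
    exact hxi ϑ t ht
  · intro ϑ ψ _ hψ t ht
    exact aux_unique hL hLip (hxc ϑ) (hxi ϑ) hψ t ht
  intro n N _ k hkN
  have hFnm : ∀ i, Measurable (Fn i) := by
    intro i
    have h1 : Fn i = fun ω => (α i)⁻¹ • (θ (i + 1) ω - θ i ω) := by
      ext1 ω
      rw [hrec i ω, add_sub_cancel_left, smul_smul, inv_mul_cancel₀ (hα i).ne', one_smul]
    rw [h1]
    have h2 := (hadapted (i + 1)).mono (𝔉.le _) le_rfl
    have h3 := (hadapted i).mono (𝔉.le _) le_rfl
    exact (h2.sub h3).const_smul ((α i)⁻¹)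
  have hFnL : ∀ i, MemLp (Fn i) 2 μ := fun i =>
    (memLp_two_iff_integrable_sq_norm (hFnm i).aestronglyMeasurable).2 (hFnint i)
  have hbd : ∀ i, ∀ᵐ ω ∂μ, ‖F (θ i ω)‖ ≤ K := fun i =>
    aux_bound hK (hFnint i) (hmean i) (hsecond i)
  have hθm : ∀ i, Measurable (θ i) := fun i => (hadapted i).mono (𝔉.le _) le_rfl
  have hFL : ∀ i, MemLp (fun ω => F (θ i ω)) 2 μ := fun i =>
    MemLp.of_bound (hF.measurable.comp (hθm i)).aestronglyMeasurable K (hbd i)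
  set t : ℕ → ℝ := fun k => ∑ i ∈ Finset.range k, α (n + i) with htdef
  set e : ℕ → ℝ := fun k => ∑ i ∈ Finset.range k, (α (n + i)) ^ 2 with hedef
  have ht0 : ∀ k, 0 ≤ t k := fun k => Finset.sum_nonneg fun i _ => (hα _).le
  have he0 : ∀ k, 0 ≤ e k := fun k => Finset.sum_nonneg fun i _ => sq_nonneg _
  have hts : ∀ k, t (k + 1) = t k + α (n + k) := fun k => Finset.sum_range_succ _ _
  have hes : ∀ k, e (k + 1) = e k + α (n + k) ^ 2 := fun k => Finset.sum_range_succ _ _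
  set B : ℕ → ℝ := fun k => (L * K / 2 * e k + K * Real.sqrt (e k)) * Real.exp (L * t k) with hBdef
  have main : ∀ k, MemLp (fun ω => θ (n + k) ω - x (θ n ω) (t k)) 2 μ ∧
      ∀ᵐ ω ∂μ, (μ[fun ω' => ‖θ (n + k) ω' - x (θ n ω') (t k)‖ ^ 2 | 𝔉 n]) ω ≤ B k ^ 2 := by
    have hz : ∀ ω, θ (n + 0) ω - x (θ n ω) (t 0) = 0 := by
      intro ω
      have : t 0 = 0 := by simp [htdef]
      rw [this, hxi (θ n ω) 0 le_rfl]; simp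
    intro k
    induction k with
    | zero =>
      simp only [hz]
      refine ⟨MemLp.zero', ?_⟩
      have : (fun _ : Ω => ‖(0 : EuclideanSpace ℝ (Fin D))‖ ^ 2) = 0 := by ext; simp
      rw [this, condExp_zero]
      exact ae_of_all _ fun ω => sq_nonneg _
    | succ k ih =>
      obtain ⟨ihL, ihB⟩ := ih
      have ha := hα (n + k)
      have hWm : Measurable[𝔉 (n + k)] fun ω => θ (n + k) ω - x (θ n ω) (t (k + 1)) := by
        have h1 := hadapted (n + k)
        have h2 : Measurable[𝔉 (n + k)] (θ n) := (hadapted n).mono (𝔉.mono (by omega)) le_rfl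
        exact h1.sub ((hcont _ (ht0 (k + 1))).measurable.comp h2)
      have hA : ∀ᵐ ω ∂μ, ‖(θ (n + k) ω - x (θ n ω) (t (k + 1))) + α (n + k) • F (θ (n + k) ω)‖
          ≤ Real.exp (L * α (n + k)) *
            (‖θ (n + k) ω - x (θ n ω) (t k)‖ + K * (L * α (n + k) ^ 2 / 2)) := by
        filter_upwards [hbd (n + k)] with ω hω
        have h1 := aux_euler hL hLip (hxc (θ (n + k) ω)) (hxi (θ (n + k) ω)) ha.le
        have h2 := hlip (α (n + k)) ha.le (θ (n + k) ω) (x (θ n ω) (t k))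
        rw [hts, hsemi _ (ht0 k) _ ha.le]
        have h3 : (θ (n + k) ω - x (x (θ n ω) (t k)) (α (n + k))) + α (n + k) • F (θ (n + k) ω)
          = (θ (n + k) ω + α (n + k) • F (θ (n + k) ω) - x (θ (n + k) ω) (α (n + k)))
            + (x (θ (n + k) ω) (α (n + k)) - x (x (θ n ω) (t k)) (α (n + k))) := by abel
        rw [h3]
        have h4 : ‖F (θ (n + k) ω)‖ * (L * α (n + k) ^ 2 / 2) * Real.exp (L * α (n + k))
          ≤ K * (L * α (n + k) ^ 2 / 2) * Real.exp (L * α (n + k)) := by gcongr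
        refine (norm_add_le _ _).trans ?_
        linarith
      have hWm0 : Measurable fun ω => θ (n + k) ω - x (θ n ω) (t (k + 1)) :=
        hWm.mono (𝔉.le _) le_rfl
      have hAL : MemLp (fun ω => (θ (n + k) ω - x (θ n ω) (t (k + 1)))
          + α (n + k) • F (θ (n + k) ω)) 2 μ := by
        have hd : MemLp (fun ω => Real.exp (L * α (n + k)) *
            (‖θ (n + k) ω - x (θ n ω) (t k)‖ + K * (L * α (n + k) ^ 2 / 2))) 2 μ :=
          (ihL.norm.add (memLp_const _)).const_mul _
        refine MemLp.mono' hd ?_ hA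
        exact hWm0.aestronglyMeasurable.add ((hFL (n + k)).1.const_smul (α (n + k)))
      have hWL : MemLp (fun ω => θ (n + k) ω - x (θ n ω) (t (k + 1))) 2 μ := by
        have h := hAL.sub ((hFL (n + k)).const_smul (α (n + k)))
        refine h.ae_eq (ae_of_all _ fun ω => ?_)
        simp
      have heq : ∀ ω, θ (n + (k + 1)) ω - x (θ n ω) (t (k + 1))
          = (θ (n + k) ω - x (θ n ω) (t (k + 1))) + α (n + k) • Fn (n + k) ω := by
        intro ω
        rw [← add_assoc, hrec (n + k) ω]; abel
      simp only [heq]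
      refine ⟨hWL.add ((hFnL (n + k)).const_smul (α (n + k))), ?_⟩
      have hBk : 0 < B k ∨ (B k = 0 ∧ ∀ ω, θ (n + k) ω - x (θ n ω) (t k) = 0) := by
        rcases Nat.eq_zero_or_pos k with rfl | hk
        · right
          refine ⟨?_, hz⟩
          simp [hBdef, hedef]
        · left
          have : 0 < e k := Finset.sum_pos (fun i _ => pow_pos (hα _) 2)
            ⟨0, Finset.mem_range.2 hk⟩
          simp only [hBdef]
          positivity
      have hs := aux_step (𝔉.mono (by omega : n ≤ n + k)) (𝔉.le (n + k))
        hWm.stronglyMeasurable hWL (hFnL (n + k)) ihL (hmean (n + k)) (hsecond (n + k)) hA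
        (by positivity) hBk ihB
      have har := aux_arith (B := B k) hL hK (he0 k) rfl (ht0 k) ha
      rw [← hes, ← hts] at har
      filter_upwards [hs] with ω hω
      exact hω.trans har
  have hBN : B k ≤ B N := by
    have h1 : e k ≤ e N := Finset.sum_le_sum_of_subset_of_nonneg
      (Finset.range_subset_range.2 hkN) fun i _ _ => sq_nonneg _
    have h2 : t k ≤ t N := Finset.sum_le_sum_of_subset_of_nonneg
      (Finset.range_subset_range.2 hkN) fun i _ _ => (hα _).le
    have := he0 k
    have := he0 N
    simp only [hBdef]
    gcongr
  have hB0 : 0 ≤ B k := by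
    have := he0 k
    simp only [hBdef]
    positivity
  filter_upwards [(main k).2] with ω hω
  refine le_trans ?_ hBN
  exact (Real.sqrt_le_sqrt hω).trans (Real.sqrt_sq hB0).le
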